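/- Let F(r) = r·f(r) with f(r) = (1 + exp(ε/r + ε/(r+ε) + 1))⁻¹ on (-ε, 0). Then (F²)''(r) < 2 for all r ∈ (-ε, 0). -/

import Mathlib

open Real

/-- The sum of the first four terms of the exponential series is a lower bound on `[0, ∞)`. -/
lemma cubic_le_exp {x : ℝ} (hx : 0 ≤ x) : 1 + x + x ^ 2 / 2 + x ^ 3 / 6 ≤ exp x := by
  have h := Real.sum_le_exp_of_nonneg hx 4
  norm_num [Finset.sum_range_succ, Nat.factorial] at h
  linarith

/-- The bound on the second derivative of `F²` after division by positive factors, in terms of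
`w = -r / (r + ε)`; here `E` is the exponential in the denominator of `f`. -/
lemma reduced_inequality {w E : ℝ} (hw : 0 < w) (hE : E = exp (w - 1 / w + 1)) :
    (w ^ 2 + w + 1 + 1 / w) ^ 2 * (2 * E - 1) <
      (1 + E) ^ 2 * (2 + E) + 2 * (1 + E) * (w ^ 3 + 3 * w ^ 2 + 2 * w + 1 + 1 / w) := by
  have hE0 : 0 < E := hE ▸ exp_pos _
  obtain ⟨y, hy⟩ : ∃ y, y = 1 / w := ⟨_, rfl⟩
  have hwy : w * y = 1 := by rw [hy]; field_simp
  have hy0 : 0 < y := by rw [hy]; positivity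
  rw [← hy] at hE ⊢
  obtain ⟨p, hp⟩ : ∃ p, p = w ^ 2 + w + 1 + y := ⟨_, rfl⟩
  obtain ⟨A, hA⟩ : ∃ A, A = w ^ 3 + 3 * w ^ 2 + 2 * w + 1 + y := ⟨_, rfl⟩
  rw [← hp, ← hA]
  have hA0 : 0 < A := by rw [hA]; positivity
  rcases le_or_gt w (2 / 5) with h1 | h1
  · have hy' : 5 / 2 ≤ y := by nlinarith
    have hE2 : E ≤ 1 / 2 := by
      have h2 : E ≤ exp (-1) := by rw [hE]; exact exp_le_exp.2 (by linarith)
      have h3 : exp (-1) * exp 1 = 1 := by rw [← exp_add]; simp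
      have h4 := add_one_le_exp (1 : ℝ)
      nlinarith [exp_pos (-1 : ℝ)]
    have : p ^ 2 * (2 * E - 1) ≤ 0 :=
      mul_nonpos_of_nonneg_of_nonpos (sq_nonneg p) (by linarith)
    have : 0 < (1 + E) ^ 2 * (2 + E) + 2 * (1 + E) * A := by positivity
    linarith
  rcases le_or_gt w (7 / 5) with h2 | h2
  · have hp2 : p ^ 2 = w ^ 4 + 2 * w ^ 3 + 3 * w ^ 2 + 4 * w + 3 + 2 * y + y ^ 2 := by
      rw [hp]; linear_combination (2 * w + 2) * hwy
    have hslope : p ^ 2 - A ≤ 14 := by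
      have hq : 0 ≤ (w - 2 / 5) * (7 / 5 - w) := mul_nonneg (by linarith) (by linarith)
      have hy1 : 14 / 25 * y ≤ 9 / 5 - w := by
        linear_combination mul_nonneg hq hy0.le + (9 / 5 - w) * hwy
      have hy2 : 14 / 25 * y ^ 2 ≤ 9 / 5 * y - 1 := by
        linear_combination mul_nonneg hq (sq_nonneg y) + (9 / 5 * y - w * y - 1) * hwy
      rw [hp2, hA]
      nlinarith [mul_nonneg hq hw.le, mul_nonneg hq (sq_nonneg w)]
    have hconst : 23 ≤ 2 + 2 * A + p ^ 2 := by
      have hy1 : 18 / 5 - (9 / 5) ^ 2 * w ≤ y := by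
        linear_combination mul_nonneg hy0.le (sq_nonneg (1 - 9 / 5 * w)) +
          (-18 / 5 + (9 / 5) ^ 2 * w) * hwy
      rw [hp2, hA]
      nlinarith [sq_nonneg (y - 9 / 5), sq_nonneg (w - 5 / 9), sq_nonneg (w ^ 2 - 25 / 81),
        mul_nonneg hw.le (sq_nonneg (w - 5 / 9))]
    have hcube : 3 * (7 / 4) ^ 2 * E - 2 * (7 / 4) ^ 3 ≤ E ^ 3 := by
      nlinarith [mul_nonneg (by linarith : (0 : ℝ) ≤ E + 7 / 2) (sq_nonneg (E - 7 / 4))]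
    have hE_slope := mul_nonneg hE0.le (sub_nonneg.2 hslope)
    nlinarith [sq_nonneg (E - 7 / 4)]
  · obtain ⟨s, hs⟩ : ∃ s, s = w - 7 / 5 := ⟨_, rfl⟩
    have hs0 : 0 < s := by linarith
    have hy' : y ≤ 5 / 7 := by nlinarith
    obtain ⟨T, hT⟩ : ∃ T, T = 1 + (s + 59 / 35) + (s + 59 / 35) ^ 2 / 2 +
      (s + 59 / 35) ^ 3 / 6 := ⟨_, rfl⟩
    have hTE : T ≤ E := by
      rw [hE, hT]
      exact (cubic_le_exp (by linarith)).trans (exp_le_exp.2 (by linarith))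
    have hT0 : 0 < T := by rw [hT]; positivity
    have hTE_sq : (T + 2) ^ 2 ≤ (E + 2) ^ 2 := by gcongr
    have hp_le : p ^ 2 ≤ (w ^ 2 + w + 12 / 7) ^ 2 := by
      have hp0 : 0 ≤ p := by rw [hp]; positivity
      gcongr
      linarith
    have hpoly : 2 * (w ^ 2 + w + 12 / 7) ^ 2 ≤
        (T + 2) ^ 2 + 1 + 2 * (w ^ 3 + 3 * w ^ 2 + 2 * w + 1) := by
      obtain rfl : w = s + 7 / 5 := by linarith
      rw [← sub_nonneg, hT]
      ring_nf
      positivity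
    have hmain : 0 ≤ E ^ 2 + 4 * E + 5 + 2 * A - 2 * p ^ 2 := by linarith
    nlinarith [mul_nonneg hE0.le hmain, sq_nonneg p]

theorem rf_sq_second_deriv_lt_two (ε : ℝ) (hε : ε > 0)
    (f F : ℝ → ℝ)
    (hf : f = fun r : ℝ => (1 + Real.exp (ε / r + ε / (r + ε) + 1))⁻¹)
    (hF : F = fun r : ℝ => r * f r) :
    ∀ r ∈ Set.Ioo (-ε) (0:ℝ), iteratedDeriv 2 (fun s => (F s)^2) r < 2 := by
  rintro r ⟨hr1, hr2⟩
  have hexp : ∀ s ∈ Set.Ioo (-ε) (0 : ℝ),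
      HasDerivAt (fun r => exp (ε / r + ε / (r + ε) + 1))
        (exp (ε / s + ε / (s + ε) + 1) * (-ε / s ^ 2 - ε / (s + ε) ^ 2)) s := by
    rintro s ⟨hs1, hs2⟩
    have hs : s ≠ 0 := hs2.ne
    have hsε : s + ε ≠ 0 := by linarith
    have h1 := (hasDerivAt_const s ε).fun_div (hasDerivAt_id' s) hs
    have h2 := (hasDerivAt_const s ε).fun_div ((hasDerivAt_id' s).add_const ε) hsε
    refine ((h1.fun_add h2).add_const 1).exp.congr_deriv ?_
    ring
  have hfirst : ∀ s ∈ Set.Ioo (-ε) (0 : ℝ), HasDerivAt (fun s => (F s) ^ 2)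
      (2 * s / (1 + exp (ε / s + ε / (s + ε) + 1)) ^ 2 +
        2 * exp (ε / s + ε / (s + ε) + 1) * (ε + ε * s ^ 2 / (s + ε) ^ 2) /
          (1 + exp (ε / s + ε / (s + ε) + 1)) ^ 3) s := by
    intro s hs
    have hs0 : s ≠ 0 := hs.2.ne
    have hsε : s + ε ≠ 0 := by linarith [hs.1]
    have hpos : 1 + exp (ε / s + ε / (s + ε) + 1) ≠ 0 := by positivity
    subst hF hf
    refine (((hasDerivAt_id' s).fun_mul
      (((hexp s hs).const_add 1).fun_inv hpos)).fun_pow 2).congr_deriv ?_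
    generalize exp (ε / s + ε / (s + ε) + 1) = E at hpos ⊢
    simp only [Nat.reduceSub, pow_one]
    field_simp
    ring
  have hderiv : deriv (fun s => (F s) ^ 2) =ᶠ[nhds r] _ :=
    Filter.eventually_of_mem (Ioo_mem_nhds hr1 hr2) fun s hs => (hfirst s hs).deriv
  rw [iteratedDeriv_succ, iteratedDeriv_one, hderiv.deriv_eq]
  have hr0 : r ≠ 0 := hr2.ne
  have hrε : r + ε ≠ 0 := by linarith
  have hE1 : 1 + exp (ε / r + ε / (r + ε) + 1) ≠ 0 := by positivity
  have hden := (hexp r ⟨hr1, hr2⟩).const_add 1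
  have hnum := ((((hasDerivAt_id' r).fun_pow 2).const_mul ε).fun_div
    (((hasDerivAt_id' r).add_const ε).fun_pow 2) (pow_ne_zero 2 hrε)).const_add ε
  have hsecond := (((hasDerivAt_id' r).const_mul 2).fun_div (hden.fun_pow 2)
    (pow_ne_zero 2 hE1)).fun_add ((((hexp r ⟨hr1, hr2⟩).const_mul 2).fun_mul hnum).fun_div
    (hden.fun_pow 3) (pow_ne_zero 3 hE1))
  rw [hsecond.deriv]
  obtain ⟨w, hw⟩ : ∃ w, w = -r / (r + ε) := ⟨_, rfl⟩
  have hw0 : 0 < w := by rw [hw]; exact div_pos (by linarith) (by linarith)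
  have hx : ε / r + ε / (r + ε) + 1 = w - 1 / w + 1 := by
    rw [hw]; field_simp; ring
  obtain ⟨E, hE⟩ : ∃ E, E = exp (ε / r + ε / (r + ε) + 1) := ⟨_, rfl⟩
  have hE0 : 0 < E := hE ▸ exp_pos _
  have key := reduced_inequality hw0 (hE.trans (by rw [hx]))
  rw [← hE]
  have hadd : r + ε = ε / (1 + w) := by
    have : 1 + w = ε / (r + ε) := by rw [hw]; field_simp; ring
    rw [this]; field_simp
  have hr : r = -(ε * w / (1 + w)) := by
    rw [eq_sub_of_add_eq hadd]; field_simp; ring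
  rw [hadd, hr]
  calc _ = 2 - 2 * E / (1 + E) ^ 4 * ((1 + E) ^ 2 * (2 + E) +
        2 * (1 + E) * (w ^ 3 + 3 * w ^ 2 + 2 * w + 1 + 1 / w) -
        (w ^ 2 + w + 1 + 1 / w) ^ 2 * (2 * E - 1)) := by
        simp only [Nat.reduceSub, pow_one]
        field_simp
        ring
    _ < 2 := sub_lt_self _ (mul_pos (by positivity) (sub_pos.2 key))
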